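/- Let A be a finite alphabet, a ∈ A, and σ a morphism of A* prolongable on a such that all letters of A occur in u = σ^ω(a), and assume the spectral radius θ of M_σ satisfies θ > 1. Then some letter with maximal growth occurs infinitely often in u. -/

import Mathlib

/-- `w` is a prefix of the infinite word `a`. -/
def IsPrefOf {A : Type*} (w : List A) (a : ℕ → A) : Prop :=
  ∀ i : Fin w.length, w.get i = a i

/-- Fractional power `V^α`: `V^⌊α⌋` followed by the prefix of `V`
of length `⌈{α}·|V|⌉`. -/
noncomputable def fracPow {A : Type*} (V : List A) (α : ℝ) : List A :=
  (List.replicate ⌊α⌋₊ V).flatten ++ V.take ⌈Int.fract α * V.length⌉₊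

/-- The set of admissible exponents in the definition of the Diophantine exponent. -/
def dioSet {A : Type*} (a : ℕ → A) : Set ℝ :=
  {ρ | ∀ N : ℕ, ∃ (U V : List A) (α : ℝ), V ≠ [] ∧ 1 ≤ α ∧
    IsPrefOf (U ++ fracPow V α) a ∧ N ≤ (U ++ fracPow V α).length ∧
    ρ ≤ ((U ++ fracPow V α).length : ℝ) / ((U.length : ℝ) + (V.length : ℝ))}

/-- Diophantine exponent of an infinite word. -/
noncomputable def dio {A : Type*} (a : ℕ → A) : EReal :=
  sSup ((fun ρ : ℝ => (ρ : EReal)) '' dioSet a)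

/-- Action of a morphism (given by its values on letters) on a finite word. -/
def mapW {A : Type*} (σ : A → List A) (w : List A) : List A := w.flatMap σ

/-- `n`-th iterate of a morphism applied to a word. -/
def iterW {A : Type*} (σ : A → List A) (n : ℕ) (w : List A) : List A :=
  (mapW σ)^[n] w

/-- `σ` is prolongable on the letter `a`. -/
def Prolongable {A : Type*} (σ : A → List A) (a : A) : Prop :=
  (∃ W : List A, W ≠ [] ∧ σ a = a :: W) ∧
  Filter.Tendsto (fun n => (iterW σ n [a]).length) Filter.atTop Filter.atTop

/-- The letter `b` has maximal growth for `σ`. -/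
def MaxGrowth {A : Type*} (σ : A → List A) (b : A) : Prop :=
  ∃ C : ℝ, ∀ c : A, ∀ n : ℕ, 1 ≤ n →
    ((iterW σ n [c]).length : ℝ) < C * ((iterW σ n [b]).length : ℝ)

/-- Incidence matrix of a morphism, viewed over `ℂ`. -/
noncomputable def incMat {A : Type*} [Fintype A] [DecidableEq A]
    (σ : A → List A) : Matrix A A ℂ :=
  fun i j => ((σ j).count i : ℂ)

/-- Spectral radius of the incidence matrix of a morphism. -/
noncomputable def specRad {A : Type*} [Fintype A] [DecidableEq A]
    (σ : A → List A) : ℝ :=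
  sSup ((fun μ : ℂ => ‖μ‖) '' spectrum ℂ (incMat σ))

open Asymptotics Filter

lemma isBigO_pow_mul_pow {d₁ d₂ : ℕ} {ρ₁ ρ₂ : ℝ} (h₁ : 0 ≤ ρ₁)
    (h : toLex (ρ₁, d₁) ≤ toLex (ρ₂, d₂)) :
    (fun n : ℕ => (n : ℝ) ^ d₁ * ρ₁ ^ n) =O[atTop] fun n : ℕ => (n : ℝ) ^ d₂ * ρ₂ ^ n := by
  rcases Prod.Lex.toLex_le_toLex.1 h with h | ⟨h, hd⟩
  · have h' : ‖ρ₁‖ < ρ₂ := by rwa [Real.norm_of_nonneg h₁]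
    refine (isLittleO_pow_const_mul_const_pow_const_pow_of_norm_lt d₁ h').isBigO.trans ?_
    refine IsBigO.of_bound 1 ?_
    filter_upwards [eventually_ge_atTop 1] with n hn
    have : (1 : ℝ) ≤ (n : ℝ) ^ d₂ := one_le_pow₀ (by exact_mod_cast hn)
    have h2 : 0 ≤ ρ₂ ^ n := pow_nonneg (h₁.trans h.le) n
    rw [Real.norm_of_nonneg h2, Real.norm_of_nonneg (by positivity)]
    nlinarith
  · dsimp only at h hd
    subst h
    refine IsBigO.of_bound 1 ?_
    filter_upwards [eventually_ge_atTop 1] with n hn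
    have : (n : ℝ) ^ d₁ ≤ (n : ℝ) ^ d₂ := pow_le_pow_right₀ (by exact_mod_cast hn) hd
    have h2 : 0 ≤ ρ₁ ^ n := pow_nonneg h₁ n
    rw [Real.norm_of_nonneg (by positivity), Real.norm_of_nonneg (by positivity), one_mul]
    gcongr

lemma isTheta_zero_pow_of_eventually_zero {V : Type*} [NormedAddCommGroup V] {f : ℕ → V}
    (h : ∀ᶠ n in atTop, f n = 0) :
    f =Θ[atTop] fun n : ℕ => (n : ℝ) ^ 0 * (0 : ℝ) ^ n := by
  have h0 : (fun n : ℕ => (n : ℝ) ^ 0 * (0 : ℝ) ^ n) =ᶠ[atTop] fun _ => 0 := by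
    filter_upwards [eventually_ge_atTop 1] with n hn
    simp [Nat.one_le_iff_ne_zero.1 hn]
  exact (isTheta_zero_right.2 h).trans_eventuallyEq h0.symm

section LinearGrowth

variable {V : Type*} [NormedAddCommGroup V] [NormedSpace ℂ V]

lemma isTheta_choose_mul_pow_smul {μ : ℂ} (hμ : μ ≠ 0) {w : V} (hw : w ≠ 0) (m : ℕ) :
    (fun n : ℕ => ((n.choose m : ℂ) * μ ^ (n - m)) • w) =Θ[atTop]
      fun n : ℕ => (n : ℝ) ^ m * ‖μ‖ ^ n := by
  have h1 : (fun n : ℕ => (n.choose m : ℂ)) =Θ[atTop] fun n : ℕ => (n : ℝ) ^ m := by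
    refine IsTheta.trans (IsTheta.of_norm_eventuallyEq_norm ?_) (isTheta_choose m)
    exact Eventually.of_forall fun n => by simp
  have h2 : (fun n : ℕ => μ ^ (n - m)) =Θ[atTop] fun n : ℕ => ‖μ‖ ^ n := by
    have : (fun n : ℕ => μ ^ (n - m)) =ᶠ[atTop] fun n => (μ ^ m)⁻¹ * μ ^ n := by
      filter_upwards [eventually_ge_atTop m] with n hn
      rw [pow_sub₀ _ hμ hn, mul_comm]
    refine this.trans_isTheta ((isTheta_const_mul_left (inv_ne_zero (pow_ne_zero m hμ))).2 ?_)
    exact IsTheta.of_norm_eventuallyEq_norm (Eventually.of_forall fun n => by simp)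
  simpa using (h1.mul h2).smul (isTheta_const_const (l := atTop) hw (one_ne_zero (α := ℝ)))

lemma exists_isTheta_of_mem_maxGenEigenspace (T : Module.End ℂ V) {μ : ℂ} {v : V}
    (hv : v ∈ T.maxGenEigenspace μ) :
    ∃ (d : ℕ) (ρ : ℝ), 0 ≤ ρ ∧
      (fun n : ℕ => (T ^ n) v) =Θ[atTop] fun n : ℕ => (n : ℝ) ^ d * ρ ^ n := by
  classical
  have hex := (Module.End.mem_maxGenEigenspace T μ v).1 hv
  by_cases hμ : μ = 0
  · subst hμ
    obtain ⟨k, hk⟩ := hex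
    rw [zero_smul, sub_zero] at hk
    refine ⟨0, 0, le_rfl, isTheta_zero_pow_of_eventually_zero ?_⟩
    filter_upwards [eventually_ge_atTop k] with n hn
    exact Module.End.pow_map_zero_of_le hn hk
  by_cases hv0 : v = 0
  · exact ⟨0, 0, le_rfl, isTheta_zero_pow_of_eventually_zero (by simp [hv0])⟩
  set N : Module.End ℂ V := T - μ • 1 with hN
  have hk0 : Nat.find hex ≠ 0 := by
    intro h0
    have := Nat.find_spec hex
    rw [h0] at this
    exact hv0 (by simpa using this)
  obtain ⟨d, hd⟩ := Nat.exists_eq_succ_of_ne_zero hk0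
  have hNd : (N ^ d) v ≠ 0 := Nat.find_min hex (by omega)
  have hNz : ∀ m, d < m → (N ^ m) v = 0 := fun m hm => by
    have := Nat.find_spec hex
    rw [hd] at this
    exact Module.End.pow_map_zero_of_le hm this
  have hexp : (fun n : ℕ => (T ^ n) v) =ᶠ[atTop] fun n =>
      ∑ m ∈ Finset.range (d + 1), ((n.choose m : ℂ) * μ ^ (n - m)) • (N ^ m) v := by
    filter_upwards [eventually_ge_atTop d] with n hn
    have hT : T = N + μ • 1 := by simp [hN]
    have hc : Commute N (μ • (1 : Module.End ℂ V)) := (Commute.one_right N).smul_right μ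
    rw [hT, hc.add_pow, LinearMap.sum_apply]
    symm
    refine Finset.sum_subset_zero_on_sdiff (Finset.range_mono (by omega)) ?_ ?_
    · intro m hm
      simp only [Finset.mem_sdiff, Finset.mem_range] at hm
      rw [(hc.pow_pow m _).eq, mul_assoc, ← Nat.cast_comm]
      simp [Module.End.mul_apply, hNz m (by omega)]
    · intro m _
      simp [smul_pow, Module.End.mul_apply, mul_smul, smul_comm (n.choose m : ℂ), Nat.cast_smul_eq_nsmul]
  refine ⟨d, ‖μ‖, norm_nonneg μ, hexp.trans_isTheta ?_⟩
  simp only [Finset.sum_range_succ]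
  refine IsLittleO.add_isTheta ?_ (isTheta_choose_mul_pow_smul hμ hNd d)
  refine IsLittleO.fun_sum fun m hm => ?_
  have hle : (fun n : ℕ => ((n.choose m : ℂ) * μ ^ (n - m)) • (N ^ m) v) =O[atTop]
      fun n : ℕ => (n : ℝ) ^ m * ‖μ‖ ^ n := by
    by_cases hw : (N ^ m) v = 0
    · simpa [hw] using isBigO_zero _ _
    · exact (isTheta_choose_mul_pow_smul hμ hw m).1
  refine hle.trans_isLittleO (IsLittleO.mul_isBigO ?_ (isBigO_refl _ _))
  exact (isLittleO_pow_pow_atTop_of_lt (Finset.mem_range.1 hm)).comp_tendsto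
    tendsto_natCast_atTop_atTop

lemma exists_isTheta_pow_apply [FiniteDimensional ℂ V] (T : Module.End ℂ V) (v : V) :
    ∃ (d : ℕ) (ρ : ℝ), 0 ≤ ρ ∧
      (fun n : ℕ => (T ^ n) v) =Θ[atTop] fun n : ℕ => (n : ℝ) ^ d * ρ ^ n := by
  have hv : v ∈ ⨆ μ, T.maxGenEigenspace μ := by
    rw [Module.End.iSup_maxGenEigenspace_eq_top]; trivial
  obtain ⟨f, hf, hsum⟩ := (Submodule.mem_iSup_iff_exists_finsupp _ _).1 hv
  have hTf : ∀ (n : ℕ) μ, (T ^ n) (f μ) ∈ T.maxGenEigenspace μ := fun n μ =>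
    Module.End.mapsTo_maxGenEigenspace_of_comm (Commute.pow_right rfl n) μ (hf μ)
  have hTv : ∀ n : ℕ, (T ^ n) v = ∑ μ ∈ f.support, (T ^ n) (f μ) := fun n => by
    rw [← hsum, Finsupp.sum, map_sum]
  choose d ρ hρ hθ using fun μ => exists_isTheta_of_mem_maxGenEigenspace T (hf μ)
  rcases f.support.eq_empty_or_nonempty with h0 | hne
  · exact ⟨0, 0, le_rfl, isTheta_zero_pow_of_eventually_zero (by simp [hTv, h0])⟩
  obtain ⟨ν, hν, hmax⟩ := f.support.exists_max_image (fun μ => toLex (ρ μ, d μ)) hne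
  refine ⟨d ν, ρ ν, hρ ν, ?_, (hθ ν).2.trans ?_⟩
  · simp only [hTv]
    exact IsBigO.fun_sum fun μ hμ => (hθ μ).1.trans (isBigO_pow_mul_pow (hρ μ) (hmax μ hμ))
  · have hind := Module.End.independent_maxGenEigenspace T
    have hcompl : IsCompl (T.maxGenEigenspace ν) (⨆ (μ) (_ : μ ≠ ν), T.maxGenEigenspace μ) := by
      refine ⟨hind ν, codisjoint_iff.2 (eq_top_iff.2 ?_)⟩
      rw [← Module.End.iSup_maxGenEigenspace_eq_top T]
      refine iSup_le fun μ => ?_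
      by_cases h : μ = ν
      · exact h ▸ le_sup_left
      · exact le_sup_of_le_right
          (le_iSup₂_of_le (f := fun μ (_ : μ ≠ ν) => T.maxGenEigenspace μ) μ h le_rfl)
    set π := Submodule.projection _ _ hcompl
    have hπ : ∀ n, (T ^ n) (f ν) = π ((T ^ n) v) := fun n => by
      rw [hTv, map_sum, Finset.sum_eq_single_of_mem ν hν]
      · exact (Submodule.projection_apply_of_mem_left hcompl (hTf n ν)).symm
      · intro μ _ h
        refine (Submodule.projection_apply_eq_zero_iff hcompl).2 ?_
        exact (le_iSup₂_of_le (f := fun μ (_ : μ ≠ ν) => T.maxGenEigenspace μ) μ h le_rfl) (hTf n μ)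
    simp only [hπ]
    exact (LinearMap.toContinuousLinearMap π).isBigO_comp _ _

end LinearGrowth

section Words

variable {A : Type*} (σ : A → List A)

lemma iterW_append (n : ℕ) (x y : List A) :
    iterW σ n (x ++ y) = iterW σ n x ++ iterW σ n y := by
  induction n generalizing x y with
  | zero => rfl
  | succ n ih =>
    simp only [iterW, Function.iterate_succ_apply] at ih ⊢
    rw [← ih, mapW, List.flatMap_append]
    rfl

lemma iterW_add (m n : ℕ) (w : List A) : iterW σ (m + n) w = iterW σ m (iterW σ n w) :=
  Function.iterate_add_apply _ m n w

lemma iterW_comm (m n : ℕ) (w : List A) :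
    iterW σ m (iterW σ n w) = iterW σ n (iterW σ m w) := by
  rw [← iterW_add, ← iterW_add, add_comm]

lemma iterW_nil (n : ℕ) : iterW σ n [] = [] :=
  Function.iterate_fixed rfl n

lemma iterW_cons (n : ℕ) (c : A) (w : List A) :
    iterW σ n (c :: w) = iterW σ n [c] ++ iterW σ n w :=
  iterW_append σ n [c] w

lemma length_iterW_le_of_mem {w : List A} {c : A} (hc : c ∈ w) (n : ℕ) :
    (iterW σ n [c]).length ≤ (iterW σ n w).length := by
  obtain ⟨s, t, rfl⟩ := List.append_of_mem hc
  rw [iterW_append, iterW_cons σ n c t]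
  simp only [List.length_append]
  omega

lemma exists_length_iterW_le [Finite A] (m : ℕ) :
    ∃ K : ℕ, ∀ w : List A, (iterW σ m w).length ≤ K * w.length := by
  obtain ⟨K, hK⟩ := (Set.finite_range fun c => (iterW σ m [c]).length).bddAbove
  refine ⟨K, fun w => ?_⟩
  induction w with
  | nil => simp [iterW_nil]
  | cons c w ih =>
    have hc : (iterW σ m [c]).length ≤ K := hK ⟨c, rfl⟩
    rw [iterW_cons, List.length_append, List.length_cons, mul_add]
    omega

lemma length_iterW_add_of_eq_cons {a : A} {W : List A} (ha : σ a = a :: W) (k n : ℕ) :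
    (iterW σ (n + k) [a]).length = (iterW σ k [a]).length +
      ∑ j ∈ Finset.range n, (iterW σ j (iterW σ k W)).length := by
  induction n with
  | zero => simp
  | succ n ih =>
    have : iterW σ (n + 1 + k) [a] = iterW σ (n + k) [a] ++ iterW σ (n + k) W := by
      rw [show n + 1 + k = (n + k) + 1 by ring, iterW_add]
      rw [← iterW_cons, ← ha]
      simp [iterW, mapW]
    rw [this, List.length_append, ih, Finset.sum_range_succ, iterW_add, add_assoc]

lemma isBigO_length_iterW_of_forall_mem {w : List A} {s : ℕ → ℝ}
    (h : ∀ c ∈ w, (fun n => ((iterW σ n [c]).length : ℝ)) =O[atTop] s) :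
    (fun n => ((iterW σ n w).length : ℝ)) =O[atTop] s := by
  induction w with
  | nil => simpa [iterW_nil] using isBigO_zero _ _
  | cons c w ih =>
    simp only [iterW_cons σ _ c w, List.length_append, Nat.cast_add]
    exact (h c (by simp)).add (ih fun c hc => h c (by simp [hc]))

lemma IsPrefOf.getElem_eq {w : List A} {u : ℕ → A} (h : IsPrefOf w u) {i : ℕ}
    (hi : i < w.length) : w[i] = u i := h ⟨i, hi⟩

lemma isBigO_length_iterW_prolongable [Finite A] {a : A} {u : ℕ → A}
    (hpro : Prolongable σ a) (hu : ∀ n : ℕ, IsPrefOf (iterW σ n [a]) u)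
    (hall : ∀ c : A, ∃ i : ℕ, u i = c) (c : A) :
    (fun n => ((iterW σ n [c]).length : ℝ)) =O[atTop]
      fun n => ((iterW σ n [a]).length : ℝ) := by
  obtain ⟨i, rfl⟩ := hall c
  obtain ⟨m, hm⟩ := (hpro.2.eventually_gt_atTop i).exists
  obtain ⟨K, hK⟩ := exists_length_iterW_le σ m
  have hmem : u i ∈ iterW σ m [a] := (hu m).getElem_eq hm ▸ List.getElem_mem hm
  refine IsBigO.of_bound K (Eventually.of_forall fun n => ?_)
  rw [Real.norm_of_nonneg (by positivity), Real.norm_of_nonneg (by positivity)]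
  have := (length_iterW_le_of_mem σ hmem n).trans (iterW_comm σ n m _ ▸ hK (iterW σ n [a]))
  exact_mod_cast this

lemma exists_forall_mem_iterW_infinite [Finite A] {a : A} {u : ℕ → A} {W : List A}
    (ha : σ a = a :: W)
    (hlim : Tendsto (fun n => (iterW σ n [a]).length) atTop atTop)
    (hu : ∀ n : ℕ, IsPrefOf (iterW σ n [a]) u) :
    ∃ k : ℕ, ∀ c ∈ iterW σ k W, {i : ℕ | u i = c}.Infinite := by
  have hfin : (⋃ c ∈ {c : A | {i : ℕ | u i = c}.Finite}, {i : ℕ | u i = c}).Finite :=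
    (Set.toFinite _).biUnion fun c hc => hc
  obtain ⟨N, hN⟩ := hfin.bddAbove
  obtain ⟨k, hk⟩ := (hlim.eventually_gt_atTop N).exists
  refine ⟨k, fun c hc hcfin => ?_⟩
  obtain ⟨j, hj, rfl⟩ := List.getElem_of_mem hc
  have hsucc : iterW σ (k + 1) [a] = iterW σ k [a] ++ iterW σ k W := by
    rw [iterW_add, ← iterW_cons, ← ha]
    simp [iterW, mapW]
  have hpre := hu (k + 1)
  rw [hsucc] at hpre
  have hget := hpre.getElem_eq (i := (iterW σ k [a]).length + j) (by simpa using hj)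
  rw [List.getElem_append_right (by omega)] at hget
  simp only [Nat.add_sub_cancel_left] at hget
  have := hN (Set.mem_biUnion hcfin hget.symm)
  omega

end Words

section Incidence

variable {A : Type*} [DecidableEq A]

/-- The vector counting the occurrences of each letter in a word. -/
def parikh (w : List A) : A → ℂ := fun i => (w.count i : ℂ)

lemma parikh_append (x y : List A) : parikh (x ++ y) = parikh x + parikh y := by
  ext i; simp [parikh]

lemma parikh_singleton (c : A) : parikh [c] = Pi.single c 1 := by
  ext i
  by_cases h : i = c
  · subst h; simp [parikh]
  · simp [parikh, h, Ne.symm h]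

variable [Fintype A] (σ : A → List A)

lemma toLin'_incMat_parikh (w : List A) :
    Matrix.toLin' (incMat σ) (parikh w) = parikh (mapW σ w) := by
  induction w with
  | nil =>
    have : parikh ([] : List A) = 0 := by ext i; simp [parikh]
    simp [mapW, this]
  | cons c w ih =>
    have h1 : parikh (c :: w) = parikh [c] + parikh w := parikh_append [c] w
    have h2 : mapW σ (c :: w) = σ c ++ mapW σ w := rfl
    rw [h1, h2, parikh_append, map_add, ih, parikh_singleton, Matrix.toLin'_apply,
      Matrix.mulVec_single_one]
    rfl

lemma toLin'_incMat_pow_parikh (n : ℕ) (w : List A) :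
    (Matrix.toLin' (incMat σ) ^ n) (parikh w) = parikh (iterW σ n w) := by
  induction n with
  | zero => rfl
  | succ n ih =>
    rw [pow_succ', Module.End.mul_apply, ih, toLin'_incMat_parikh, add_comm, iterW_add]
    rfl

lemma sum_norm_parikh (w : List A) : ∑ i, ‖parikh w i‖ = w.length := by
  have := Multiset.sum_count_eq_card (s := Finset.univ) (m := (w : Multiset A)) (by simp)
  simp only [Multiset.coe_count, Multiset.coe_card] at this
  simp only [parikh, Complex.norm_natCast]
  exact_mod_cast this

lemma parikh_isTheta_length (w : ℕ → List A) :
    (fun n => parikh (w n)) =Θ[atTop] fun n => ((w n).length : ℝ) := by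
  constructor
  · refine IsBigO.of_bound 1 (Eventually.of_forall fun n => ?_)
    rw [Real.norm_of_nonneg (by positivity), one_mul, ← sum_norm_parikh,
      pi_norm_le_iff_of_nonneg (by positivity)]
    exact fun i => Finset.single_le_sum (f := fun i => ‖parikh (w n) i‖)
      (fun i _ => norm_nonneg _) (Finset.mem_univ i)
  · refine IsBigO.of_bound (Fintype.card A) (Eventually.of_forall fun n => ?_)
    rw [Real.norm_of_nonneg (by positivity), ← sum_norm_parikh, ← nsmul_eq_mul]
    exact Pi.sum_norm_apply_le_norm _

lemma exists_isTheta_length_iterW (w : List A) :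
    ∃ (d : ℕ) (ρ : ℝ), 0 ≤ ρ ∧ (fun n => ((iterW σ n w).length : ℝ)) =Θ[atTop]
      fun n : ℕ => (n : ℝ) ^ d * ρ ^ n := by
  obtain ⟨d, ρ, hρ, h⟩ := exists_isTheta_pow_apply (Matrix.toLin' (incMat σ)) (parikh w)
  simp only [toLin'_incMat_pow_parikh] at h
  exact ⟨d, ρ, hρ, (parikh_isTheta_length _).symm.trans h⟩

lemma exists_pow_isBigO_of_one_lt_specRad (hθ : 1 < specRad σ) {s : ℕ → ℝ}
    (hs : ∀ c : A, (fun n => ((iterW σ n [c]).length : ℝ)) =O[atTop] s) :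
    ∃ r : ℝ, 1 < r ∧ (fun n : ℕ => r ^ n) =O[atTop] s := by
  have hne : ((fun μ : ℂ => ‖μ‖) '' spectrum ℂ (incMat σ)).Nonempty := by
    by_contra h
    rw [specRad, Set.not_nonempty_iff_eq_empty.1 h, Real.sSup_empty] at hθ
    linarith
  obtain ⟨_, ⟨μ, hμ, rfl⟩, hr⟩ := exists_lt_of_lt_csSup hne hθ
  rw [← Matrix.spectrum_toLin'] at hμ
  obtain ⟨v, hv⟩ := (Module.End.HasEigenvalue.of_mem_spectrum hμ).exists_hasEigenvector
  refine ⟨‖μ‖, hr, ?_⟩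
  set T := Matrix.toLin' (incMat σ)
  have hpow : ∀ n : ℕ, μ ^ n • v = ∑ c, v c • parikh (iterW σ n [c]) := fun n => by
    rw [← hv.pow_apply]
    conv_lhs => rw [pi_eq_sum_univ' v]
    simp only [map_sum, map_smul, ← toLin'_incMat_pow_parikh, parikh_singleton]
    rfl
  have h1 : (fun n : ℕ => ‖μ‖ ^ n) =O[atTop] fun n : ℕ => μ ^ n • v := by
    refine IsBigO.of_bound ‖v‖⁻¹ (Eventually.of_forall fun n => ?_)
    rw [norm_smul, norm_pow, norm_pow, norm_norm, mul_comm, mul_assoc,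
      mul_inv_cancel₀ (norm_ne_zero_iff.2 hv.2), mul_one]
  refine h1.trans ?_
  simp only [hpow]
  exact IsBigO.fun_sum fun c _ =>
    ((parikh_isTheta_length _).1.trans (hs c)).const_smul_left (v c)

end Incidence

lemma isBigO_const_add_sum_range {f s : ℕ → ℝ} {r : ℝ} (hr : 1 < r)
    (hs : ∀ᶠ n in atTop, 0 < s n) (hsr : ∀ᶠ n in atTop, r * s n ≤ s (n + 1))
    (hf : f =O[atTop] s) (hf0 : ∀ n, 0 ≤ f n) {C : ℝ} (hC : 0 ≤ C) :
    (fun n => C + ∑ j ∈ Finset.range n, f j) =O[atTop] s := by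
  obtain ⟨K, hK⟩ := hf.bound
  obtain ⟨N, hN⟩ := eventually_atTop.1 (hs.and (hsr.and hK))
  set F : ℕ → ℝ := fun n => C + ∑ j ∈ Finset.range n, f j with hF
  have hF0 : ∀ n, 0 ≤ F n := fun n => add_nonneg hC (Finset.sum_nonneg fun j _ => hf0 j)
  set K' := max (F N / s N) (K / (r - 1))
  have key : ∀ n ≥ N, F n ≤ K' * s n := by
    intro n hn
    induction n, hn using Nat.le_induction with
    | base => exact (div_le_iff₀ (hN N le_rfl).1).1 (le_max_left _ _)
    | succ n hn ih =>
      obtain ⟨h0, h1, h2⟩ := hN n hn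
      rw [Real.norm_of_nonneg (hf0 n), Real.norm_of_nonneg h0.le] at h2
      have hK1 : K ≤ K' * (r - 1) := (div_le_iff₀ (by linarith)).1 (le_max_right _ _)
      have hK0 : 0 ≤ K' := (div_nonneg (hF0 N) (hN N le_rfl).1.le).trans (le_max_left _ _)
      have hstep : F (n + 1) = F n + f n := by simp [hF, Finset.sum_range_succ, add_assoc]
      calc F (n + 1) ≤ K' * s n + K' * (r - 1) * s n := by
            rw [hstep]; gcongr; exact h2.trans (by gcongr)
        _ = K' * (r * s n) := by ring
        _ ≤ K' * s (n + 1) := by gcongr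
  refine IsBigO.of_bound K' (eventually_atTop.2 ⟨N, fun n hn => ?_⟩)
  rw [Real.norm_of_nonneg (hF0 n), Real.norm_of_nonneg (hN n hn).1.le]
  exact key n hn

lemma iterW_ne_nil_of_tendsto_length {A : Type*} {σ : A → List A} {a : A} {W : List A}
    (ha : σ a = a :: W)
    (hlim : Tendsto (fun n => (iterW σ n [a]).length) atTop atTop) (k : ℕ) :
    iterW σ k W ≠ [] := by
  intro h
  obtain ⟨n, hn, hnk⟩ :=
    ((hlim.eventually_gt_atTop (iterW σ k [a]).length).and (eventually_ge_atTop k)).exists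
  obtain ⟨m, rfl⟩ := Nat.exists_eq_add_of_le' hnk
  rw [length_iterW_add_of_eq_cons σ ha, h] at hn
  simp [iterW_nil] at hn

lemma maxGrowth_of_isBigO {A : Type*} [Fintype A] {σ : A → List A} {b : A}
    (hpos : ∀ n, 0 < (iterW σ n [b]).length)
    (h : ∀ c : A, (fun n => ((iterW σ n [c]).length : ℝ)) =O[atTop]
      fun n => ((iterW σ n [b]).length : ℝ)) : MaxGrowth σ b := by
  choose C hC0 hC using fun c => bound_of_isBigO_nat_atTop (h c)
  have hpos' : ∀ n, (0 : ℝ) < (iterW σ n [b]).length := fun n => by exact_mod_cast hpos n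
  refine ⟨∑ c, C c + 1, fun c n _ => ?_⟩
  have h1 := hC c (hpos' n).ne'
  rw [Real.norm_of_nonneg (by positivity), Real.norm_of_nonneg (by positivity)] at h1
  have h2 : C c ≤ ∑ c, C c :=
    Finset.single_le_sum (fun c _ => (hC0 c).le) (Finset.mem_univ c)
  nlinarith [hpos' n]

lemma length_iterW_pos_of_isBigO {A : Type*} {σ : A → List A} {a b : A}
    (hlim : Tendsto (fun n => (iterW σ n [a]).length) atTop atTop)
    (h : (fun n => ((iterW σ n [a]).length : ℝ)) =O[atTop]
      fun n => ((iterW σ n [b]).length : ℝ)) (n : ℕ) : 0 < (iterW σ n [b]).length := by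
  by_contra hn
  have hnil : iterW σ n [b] = [] := by simpa using hn
  obtain ⟨C, hC⟩ := h.bound
  obtain ⟨m, hm, hm1, hmn⟩ :=
    (hC.and ((hlim.eventually_gt_atTop 0).and (eventually_ge_atTop n))).exists
  obtain ⟨m, rfl⟩ := Nat.exists_eq_add_of_le' hmn
  rw [iterW_add σ m n [b], hnil, iterW_nil] at hm
  simp only [List.length_nil, Nat.cast_zero, norm_zero, mul_zero, norm_le_zero_iff,
    Nat.cast_eq_zero] at hm
  omega

/-- if the spectral radius exceeds 1, some letter of maximal growth
occurs infinitely often in the fixed point. -/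
theorem stmt_3 {A : Type*} [Fintype A] [DecidableEq A] (σ : A → List A) (a : A)
    (hpro : Prolongable σ a)
    (u : ℕ → A) (hu : ∀ n : ℕ, IsPrefOf (iterW σ n [a]) u)
    (hall : ∀ c : A, ∃ i : ℕ, u i = c)
    (hθ : 1 < specRad σ) :
    ∃ b : A, MaxGrowth σ b ∧ {i : ℕ | u i = b}.Infinite := by
  obtain ⟨W, -, ha⟩ := hpro.1
  have hlim := hpro.2
  obtain ⟨k, hk⟩ := exists_forall_mem_iterW_infinite σ ha hlim hu
  have hA := isBigO_length_iterW_prolongable σ hpro hu hall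
  obtain ⟨r, hr, hra⟩ := exists_pow_isBigO_of_one_lt_specRad σ hθ hA
  choose d ρ hρ hΘ using fun c => exists_isTheta_length_iterW σ [c]
  have hne : (iterW σ k W).toFinset.Nonempty :=
    List.toFinset_nonempty_iff _ |>.2 (iterW_ne_nil_of_tendsto_length ha hlim k)
  obtain ⟨b, hb, hmax⟩ := Finset.exists_max_image _ (fun c => toLex (ρ c, d c)) hne
  rw [List.mem_toFinset] at hb
  have hw : (fun n => ((iterW σ n (iterW σ k W)).length : ℝ)) =O[atTop]
      fun n : ℕ => (n : ℝ) ^ d b * ρ b ^ n :=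
    isBigO_length_iterW_of_forall_mem σ fun c hc =>
      (hΘ c).1.trans (isBigO_pow_mul_pow (hρ c) (hmax c (List.mem_toFinset.2 hc)))
  have hsum : ∀ (s : ℕ → ℝ) (q : ℝ), 1 < q → (∀ᶠ n in atTop, 0 < s n) →
      (∀ᶠ n in atTop, q * s n ≤ s (n + 1)) →
      (fun n => ((iterW σ n (iterW σ k W)).length : ℝ)) =O[atTop] s →
      (fun n => ((iterW σ n [a]).length : ℝ)) =O[atTop] s := by
    intro s q hq hs hsq hws
    refine IsBigO.trans (IsBigO.of_bound 1 (Eventually.of_forall fun n => ?_))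
      (isBigO_const_add_sum_range hq hs hsq hws (fun n => by positivity)
        (Nat.cast_nonneg (iterW σ k [a]).length))
    rw [Real.norm_of_nonneg (by positivity), Real.norm_of_nonneg (by positivity), one_mul]
    have h1 := length_iterW_add_of_eq_cons σ ha k n
    have h2 := length_iterW_add_of_eq_cons σ ha n k
    rw [add_comm k n] at h2
    have h3 : (iterW σ n [a]).length ≤ (iterW σ k [a]).length +
      ∑ j ∈ Finset.range n, (iterW σ j (iterW σ k W)).length := by omega
    exact_mod_cast h3
  have hρb : 1 < ρ b := by
    by_contra! hle
    obtain ⟨q, hq1, hqr⟩ := exists_between hr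
    have hq : (fun n => ((iterW σ n [a]).length : ℝ)) =O[atTop] fun n : ℕ => q ^ n := by
      refine hsum _ q hq1 (Eventually.of_forall fun n => by positivity)
        (Eventually.of_forall fun n => (pow_succ' q n).ge) (hw.trans ?_)
      refine (isLittleO_pow_const_mul_const_pow_const_pow_of_norm_lt (d b) ?_).isBigO
      rw [Real.norm_of_nonneg (hρ b)]
      linarith
    refine (isLittleO_pow_pow_of_lt_left (by linarith) hqr).not_isBigO ?_ (hra.trans hq)
    exact Frequently.of_forall fun n => (by positivity : q ^ n ≠ 0)
  have hab : (fun n => ((iterW σ n [a]).length : ℝ)) =O[atTop]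
      fun n => ((iterW σ n [b]).length : ℝ) := by
    refine (hsum _ (ρ b) hρb ?_ ?_ hw).trans (hΘ b).2
    · filter_upwards [eventually_gt_atTop 0] with n hn
      positivity
    · refine Eventually.of_forall fun n => ?_
      rw [pow_succ' (ρ b) n, mul_left_comm]
      push_cast
      gcongr
      linarith
  exact ⟨b, maxGrowth_of_isBigO (length_iterW_pos_of_isBigO hlim hab)
    fun c => (hA c).trans hab, hk b hb⟩
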